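/- Let X be a Hausdorff space, A ⊆ X, and set κ = skL(X, 2^{ψ(X)·t(X)}) · ψ(X) · t(X). Then |cl A| ≤ |A|^κ. -/

import Mathlib

open Cardinal Set

universe u

/-- Skew-λ Lindelöf degree of `A` in `X`. -/
noncomputable def skLrel (X : Type u) [TopologicalSpace X] (A : Set X) (lam : Cardinal.{u}) :
    Cardinal.{u} :=
  sInf {κ : Cardinal.{u} | ℵ₀ ≤ κ ∧
    ∀ 𝒰 : Set (Set X), (∀ U ∈ 𝒰, IsOpen U) → A ⊆ ⋃₀ 𝒰 →
      ∃ 𝒱 ⊆ 𝒰, #↥𝒱 ≤ κ ∧ #↥(A \ ⋃₀ 𝒱) < lam}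

/-- Skew-λ Lindelöf degree of `X`. -/
noncomputable def skL (X : Type u) [TopologicalSpace X] (lam : Cardinal.{u}) : Cardinal.{u} :=
  skLrel X Set.univ lam

/-- Lindelöf degree of `X`. -/
noncomputable def Ldeg (X : Type u) [TopologicalSpace X] : Cardinal.{u} :=
  sInf {κ : Cardinal.{u} | ℵ₀ ≤ κ ∧
    ∀ 𝒰 : Set (Set X), (∀ U ∈ 𝒰, IsOpen U) → ⋃₀ 𝒰 = Set.univ →
      ∃ 𝒱 ⊆ 𝒰, #↥𝒱 ≤ κ ∧ ⋃₀ 𝒱 = Set.univ}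

/-- Pseudocharacter of `X`. -/
noncomputable def psi (X : Type u) [TopologicalSpace X] : Cardinal.{u} :=
  sInf {κ : Cardinal.{u} | ℵ₀ ≤ κ ∧
    ∀ x : X, ∃ 𝒱 : Set (Set X), (∀ V ∈ 𝒱, IsOpen V) ∧ #↥𝒱 ≤ κ ∧ ⋂₀ 𝒱 = {x}}

/-- Closed pseudocharacter of `X`. -/
noncomputable def psic (X : Type u) [TopologicalSpace X] : Cardinal.{u} :=
  sInf {κ : Cardinal.{u} | ℵ₀ ≤ κ ∧
    ∀ x : X, ∃ 𝒱 : Set (Set X), (∀ V ∈ 𝒱, IsOpen V ∧ x ∈ V) ∧ #↥𝒱 ≤ κ ∧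
      (⋂ V ∈ 𝒱, closure V) = {x}}

/-- Tightness of `X`. -/
noncomputable def tight (X : Type u) [TopologicalSpace X] : Cardinal.{u} :=
  sInf {κ : Cardinal.{u} | ℵ₀ ≤ κ ∧
    ∀ (A : Set X) (x : X), x ∈ closure A → ∃ B ⊆ A, #↥B ≤ κ ∧ x ∈ closure B}

/-- Character of `X`. -/
noncomputable def charDeg (X : Type u) [TopologicalSpace X] : Cardinal.{u} :=
  sInf {κ : Cardinal.{u} | ℵ₀ ≤ κ ∧
    ∀ x : X, ∃ ℬ : Set (Set X), (∀ B ∈ ℬ, IsOpen B ∧ x ∈ B) ∧ #↥ℬ ≤ κ ∧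
      ∀ U : Set X, IsOpen U → x ∈ U → ∃ B ∈ ℬ, B ⊆ U}

/-- Density of `X`. -/
noncomputable def dens (X : Type u) [TopologicalSpace X] : Cardinal.{u} :=
  sInf {κ : Cardinal.{u} | ℵ₀ ≤ κ ∧ ∃ D : Set X, Dense D ∧ #↥D ≤ κ}

/-- θ-network weight of `X`. -/
noncomputable def nwTheta (X : Type u) [TopologicalSpace X] : Cardinal.{u} :=
  sInf {κ : Cardinal.{u} | ℵ₀ ≤ κ ∧
    ∃ 𝒩 : Set (Set X), 𝒩.Nonempty ∧ #↥𝒩 ≤ κ ∧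
      ∀ (x : X) (U : Set X), IsOpen U → x ∈ U → ∃ N ∈ 𝒩, x ∈ N ∧ N ⊆ closure U}

/-- Skew-λ almost Lindelöf degree of `A` in `X`. -/
noncomputable def saLrel (X : Type u) [TopologicalSpace X] (A : Set X) (lam : Cardinal.{u}) :
    Cardinal.{u} :=
  sInf {κ : Cardinal.{u} | ℵ₀ ≤ κ ∧
    ∀ 𝒰 : Set (Set X), (∀ U ∈ 𝒰, IsOpen U) → A ⊆ ⋃₀ 𝒰 →
      ∃ 𝒱 ⊆ 𝒰, #↥𝒱 ≤ κ ∧ #↥(A \ ⋃ V ∈ 𝒱, closure V) < lam}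

/-- Skew-λ almost Lindelöf degree of `X`. -/
noncomputable def saL (X : Type u) [TopologicalSpace X] (lam : Cardinal.{u}) : Cardinal.{u} :=
  saLrel X Set.univ lam

/-- Skew-λ almost Lindelöf degree of `X` with respect to closed sets. -/
noncomputable def saLc (X : Type u) [TopologicalSpace X] (lam : Cardinal.{u}) : Cardinal.{u} :=
  sSup {c : Cardinal.{u} | ∃ A : Set X, IsClosed A ∧ c = saLrel X A lam}

/-- κ-closure of a set. -/
def clk {X : Type u} [TopologicalSpace X] (κ : Cardinal.{u}) (A : Set X) : Set X :=
  ⋃ B ∈ {B : Set X | B ⊆ A ∧ #↥B ≤ κ}, closure B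

/-- Skew-λ almost Lindelöf degree of `X` with respect to κ-closed sets. -/
noncomputable def saLk (X : Type u) [TopologicalSpace X] (κ lam : Cardinal.{u}) : Cardinal.{u} :=
  sSup {c : Cardinal.{u} | ∃ A : Set X, clk κ A = A ∧ c = saLrel X A lam}

/-- Skew-λ weak Lindelöf degree of `A` in `X`. -/
noncomputable def swLrel (X : Type u) [TopologicalSpace X] (A : Set X) (lam : Cardinal.{u}) :
    Cardinal.{u} :=
  sInf {κ : Cardinal.{u} | ℵ₀ ≤ κ ∧
    ∀ 𝒰 : Set (Set X), (∀ U ∈ 𝒰, IsOpen U) → A ⊆ ⋃₀ 𝒰 →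
      ∃ 𝒱 ⊆ 𝒰, #↥𝒱 ≤ κ ∧ #↥(A \ closure (⋃₀ 𝒱)) < lam}

/-- Skew-λ weak Lindelöf degree of `X`. -/
noncomputable def swL (X : Type u) [TopologicalSpace X] (lam : Cardinal.{u}) : Cardinal.{u} :=
  swLrel X Set.univ lam

/-- Skew-λ weak Lindelöf degree of `X` with respect to closed sets. -/
noncomputable def swLc (X : Type u) [TopologicalSpace X] (lam : Cardinal.{u}) : Cardinal.{u} :=
  sSup {c : Cardinal.{u} | ∃ A : Set X, IsClosed A ∧ c = swLrel X A lam}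

/-- A nonempty set of size at most `#ι` is the range of a family indexed by `ι`. -/
theorem exists_range_eq_aux {α ι : Type u} (S : Set α) (hS : S.Nonempty) (h : #↥S ≤ #ι) :
    ∃ g : ι → α, Set.range g = S := by
  obtain ⟨e⟩ := h
  have : Nonempty S := hS.to_subtype
  refine ⟨fun i => (Function.invFun e i : S), ?_⟩
  have hs := Function.invFun_surjective e.injective
  ext y
  constructor
  · rintro ⟨i, rfl⟩
    exact (Function.invFun e i).2
  · intro hy
    obtain ⟨i, hi⟩ := hs ⟨y, hy⟩
    exact ⟨i, by simp [hi]⟩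

theorem psi_spec (X : Type u) [TopologicalSpace X] [T1Space X] :
    ℵ₀ ≤ psi X ∧
    ∀ x : X, ∃ 𝒱 : Set (Set X), (∀ V ∈ 𝒱, IsOpen V) ∧ #↥𝒱 ≤ psi X ∧ ⋂₀ 𝒱 = {x} := by
  refine csInf_mem (s := {κ : Cardinal.{u} | ℵ₀ ≤ κ ∧
    ∀ x : X, ∃ 𝒱 : Set (Set X), (∀ V ∈ 𝒱, IsOpen V) ∧ #↥𝒱 ≤ κ ∧ ⋂₀ 𝒱 = {x}})
    ⟨max ℵ₀ #(Set X), le_max_left _ _, fun x => ⟨{V | IsOpen V ∧ x ∈ V}, fun V hV => hV.1,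
      (mk_set_le _).trans (le_max_right _ _), ?_⟩⟩
  ext y
  simp only [Set.mem_sInter, Set.mem_setOf_eq, Set.mem_singleton_iff]
  constructor
  · intro h
    by_contra hne
    have := h {y}ᶜ ⟨isOpen_compl_singleton, fun hx => hne (by simpa using hx.symm)⟩
    exact this rfl
  · rintro rfl V hV
    exact hV.2

theorem tight_spec (X : Type u) [TopologicalSpace X] :
    ℵ₀ ≤ tight X ∧
    ∀ (A : Set X) (x : X), x ∈ closure A → ∃ B ⊆ A, #↥B ≤ tight X ∧ x ∈ closure B :=
  csInf_mem (s := {κ : Cardinal.{u} | ℵ₀ ≤ κ ∧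
    ∀ (A : Set X) (x : X), x ∈ closure A → ∃ B ⊆ A, #↥B ≤ κ ∧ x ∈ closure B})
    ⟨max ℵ₀ #X, le_max_left _ _, fun A x hx => ⟨A, subset_rfl,
      (mk_set_le _).trans (le_max_right _ _), hx⟩⟩

theorem skL_spec (X : Type u) [TopologicalSpace X] (lam : Cardinal.{u}) (hl : 0 < lam) :
    ℵ₀ ≤ skL X lam ∧
    ∀ 𝒰 : Set (Set X), (∀ U ∈ 𝒰, IsOpen U) → Set.univ ⊆ ⋃₀ 𝒰 →
      ∃ 𝒱 ⊆ 𝒰, #↥𝒱 ≤ skL X lam ∧ #↥(Set.univ \ ⋃₀ 𝒱) < lam := by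
  refine csInf_mem (s := {κ : Cardinal.{u} | ℵ₀ ≤ κ ∧
    ∀ 𝒰 : Set (Set X), (∀ U ∈ 𝒰, IsOpen U) → Set.univ ⊆ ⋃₀ 𝒰 →
      ∃ 𝒱 ⊆ 𝒰, #↥𝒱 ≤ κ ∧ #↥(Set.univ \ ⋃₀ 𝒱) < lam})
    ⟨max ℵ₀ #(Set X), le_max_left _ _, fun 𝒰 _ h => ⟨𝒰, subset_rfl,
      (mk_set_le _).trans (le_max_right _ _), ?_⟩⟩
  rw [Set.diff_eq_empty.2 h]
  simpa using hl

/-- Every point has at most `κ` open neighbourhoods whose closures meet in at most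
`2 ^ κ` points. -/
theorem exists_nhds_aux {X : Type u} [TopologicalSpace X] [T2Space X] (κ : Cardinal.{u})
    (hκ : ℵ₀ ≤ κ)
    (hsk : ∀ 𝒰 : Set (Set X), (∀ U ∈ 𝒰, IsOpen U) → Set.univ ⊆ ⋃₀ 𝒰 →
      ∃ 𝒱 ⊆ 𝒰, #↥𝒱 ≤ κ ∧ #↥(Set.univ \ ⋃₀ 𝒱) ≤ 2 ^ κ)
    (hpsi : ∀ x : X, ∃ 𝒱 : Set (Set X), (∀ V ∈ 𝒱, IsOpen V) ∧ #↥𝒱 ≤ κ ∧ ⋂₀ 𝒱 = {x})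
    (x : X) :
    ∃ 𝒲 : Set (Set X), 𝒲.Nonempty ∧ (∀ W ∈ 𝒲, IsOpen W ∧ x ∈ W) ∧ #↥𝒲 ≤ κ ∧
      #↥(⋂ W ∈ 𝒲, closure W) ≤ 2 ^ κ := by
  obtain ⟨𝒱, hVo, hVc, hVx⟩ := hpsi x
  have h2 : κ ≤ 2 ^ κ := (cantor κ).le
  have key : ∀ V : 𝒱, ∃ 𝒯 ⊆ insert (V : Set X) {U | IsOpen U ∧ x ∉ closure U},
      #↥𝒯 ≤ κ ∧ #↥(Set.univ \ ⋃₀ 𝒯) ≤ 2 ^ κ := by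
    intro V
    apply hsk
    · rintro U (rfl | hU)
      · exact hVo _ V.2
      · exact hU.1
    · intro y _
      by_cases hy : y = x
      · refine ⟨V, Or.inl rfl, ?_⟩
        have : x ∈ ⋂₀ 𝒱 := by rw [hVx]; rfl
        rw [hy]
        exact this _ V.2
      · obtain ⟨u, v, hu, hv, hyu, hxv, hd⟩ := t2_separation hy
        refine ⟨u, Or.inr ⟨hu, fun hx => ?_⟩, hyu⟩
        obtain ⟨z, hz1, hz2⟩ := mem_closure_iff.1 hx v hv hxv
        exact Set.disjoint_left.1 hd hz2 hz1
  choose 𝒯 hT hTc hTr using key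
  refine ⟨insert Set.univ (⋃ V : 𝒱, (fun U => (closure U)ᶜ) '' {U | U ∈ 𝒯 V ∧ x ∉ closure U}),
    ⟨_, Or.inl rfl⟩, ?_, ?_, ?_⟩
  · rintro W (rfl | hW)
    · exact ⟨isOpen_univ, trivial⟩
    · obtain ⟨V, U, hU, rfl⟩ := Set.mem_iUnion.1 hW
      exact ⟨isClosed_closure.isOpen_compl, hU.2⟩
  · refine mk_insert_le.trans (add_le_of_le hκ ?_ (one_le_aleph0.trans hκ))
    refine (mk_iUnion_le _).trans (mul_le_of_le hκ hVc ?_)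
    refine ciSup_le' fun V => mk_image_le.trans ?_
    exact (mk_le_mk_of_subset fun U hU => hU.1).trans (hTc V)
  · have hsub : (⋂ W ∈ insert Set.univ (⋃ V : 𝒱, (fun U => (closure U)ᶜ) ''
        {U | U ∈ 𝒯 V ∧ x ∉ closure U}), closure W) ⊆
        insert x (⋃ V : 𝒱, (Set.univ \ ⋃₀ 𝒯 V)) := by
      intro y hy
      by_contra hn
      simp only [Set.mem_insert_iff, not_or] at hn
      obtain ⟨hyx, hR⟩ := hn
      apply hyx
      have : y ∈ ⋂₀ 𝒱 := by
        intro V hV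
        have hyT : y ∈ ⋃₀ 𝒯 ⟨V, hV⟩ := by
          by_contra h
          exact hR (Set.mem_iUnion.2 ⟨⟨V, hV⟩, trivial, h⟩)
        obtain ⟨U, hU, hyU⟩ := hyT
        rcases hT _ hU with h | h
        · rwa [← show U = V from h]
        · exfalso
          have hm := Set.mem_iInter₂.1 hy (closure U)ᶜ
            (Or.inr (Set.mem_iUnion.2 ⟨⟨V, hV⟩, U, ⟨hU, h.2⟩, rfl⟩))
          obtain ⟨z, hz1, hz2⟩ := mem_closure_iff.1 hm U h.1 hyU
          exact hz2 (subset_closure hz1)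
      rwa [hVx] at this
    have hκ2 := hκ.trans h2
    refine (mk_le_mk_of_subset hsub).trans ?_
    refine mk_insert_le.trans (add_le_of_le hκ2 ?_ (one_le_aleph0.trans hκ2))
    refine (mk_iUnion_le _).trans (mul_le_of_le hκ2 (hVc.trans h2) ?_)
    exact ciSup_le' fun V => hTr V

theorem closure_card_aux {X : Type u} [TopologicalSpace X] (A : Set X)
    (κ : Cardinal.{u}) (hκ : ℵ₀ ≤ κ) (hA : 2 ≤ #↥A)
    (hW : ∀ x : X, ∃ 𝒲 : Set (Set X), 𝒲.Nonempty ∧ (∀ W ∈ 𝒲, IsOpen W ∧ x ∈ W) ∧ #↥𝒲 ≤ κ ∧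
      #↥(⋂ W ∈ 𝒲, closure W) ≤ 2 ^ κ)
    (ht : ∀ (A : Set X) (x : X), x ∈ closure A → ∃ B ⊆ A, #↥B ≤ κ ∧ x ∈ closure B) :
    #↥(closure A) ≤ #↥A ^ κ := by
  have key : ∀ x : closure A, ∃ f : κ.out → κ.out → A,
      (x : X) ∈ (⋂ i, closure (Set.range fun j => (f i j : X))) ∧
      #↥(⋂ i, closure (Set.range fun j => (f i j : X))) ≤ 2 ^ κ := by
    rintro ⟨x, hx⟩
    obtain ⟨𝒲, hne, hWo, hWc, hWi⟩ := hW x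
    obtain ⟨w, hw⟩ := exists_range_eq_aux (ι := κ.out) 𝒲 hne (by simpa using hWc)
    have hB : ∀ i, ∃ g : κ.out → A, x ∈ closure (Set.range fun j => (g j : X)) ∧
        (Set.range fun j => (g j : X)) ⊆ w i := by
      intro i
      obtain ⟨hwo, hxw⟩ := hWo (w i) (by rw [← hw]; exact ⟨i, rfl⟩)
      have hx' : x ∈ closure (w i ∩ A) := by
        rw [mem_closure_iff]
        intro o ho hxo
        obtain ⟨z, hz, hzA⟩ := mem_closure_iff.1 hx (o ∩ w i) (ho.inter hwo) ⟨hxo, hxw⟩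
        exact ⟨z, hz.1, hz.2, hzA⟩
      obtain ⟨B, hBs, hBc, hxB⟩ := ht _ _ hx'
      have hBne : B.Nonempty := closure_nonempty_iff.1 ⟨x, hxB⟩
      obtain ⟨g, hg⟩ := exists_range_eq_aux (ι := κ.out) B hBne (by simpa using hBc)
      have hgB : ∀ j, g j ∈ B := fun j => by rw [← hg]; exact ⟨j, rfl⟩
      refine ⟨fun j => ⟨g j, (hBs (hgB j)).2⟩, ?_, ?_⟩
      · simpa [hg] using hxB
      · rintro _ ⟨j, rfl⟩
        exact (hBs (hgB j)).1
    choose f hf1 hf2 using hB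
    refine ⟨f, Set.mem_iInter.2 hf1, (mk_le_mk_of_subset ?_).trans hWi⟩
    intro y hy
    refine Set.mem_iInter₂.2 fun W hWm => ?_
    rw [← hw] at hWm
    obtain ⟨i, rfl⟩ := hWm
    exact closure_mono (hf2 i) (Set.mem_iInter.1 hy i)
  choose f hf1 hf2 using key
  have h2A : (2 : Cardinal.{u}) ^ κ ≤ #↥A ^ κ := power_le_power_right hA
  have hfib : ∀ b, #{x // f x = b} ≤ 2 ^ κ := by
    intro b
    by_cases h : ∃ x, f x = b
    · obtain ⟨x, rfl⟩ := h
      refine le_trans ?_ (hf2 x)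
      refine mk_le_of_injective (f := fun y => ⟨(y.1 : X), ?_⟩) ?_
      · have h1 := hf1 y.1
        have h2 : f y.1 = f x := y.2
        rwa [h2] at h1
      · intro y z hyz
        have h3 : (y.1 : X) = (z.1 : X) := Subtype.mk.inj hyz
        exact Subtype.ext (Subtype.ext h3)
    · have : IsEmpty {x // f x = b} := ⟨fun y => h ⟨y.1, y.2⟩⟩
      simp
  have hinf : ℵ₀ ≤ #↥A ^ κ := hκ.trans ((cantor κ).le.trans h2A)
  rw [← mk_congr (Equiv.sigmaFiberEquiv f), mk_sigma]
  refine (sum_le_sum _ (fun _ => (2 : Cardinal.{u}) ^ κ) hfib).trans ?_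
  rw [sum_const']
  refine mul_le_of_le hinf ?_ h2A
  simp only [← power_def, mk_out, ← power_mul, mul_eq_self hκ, le_refl]

/-- Lemma 3.7: for κ = skL(X,2^{ψ(X)·t(X)})·ψ(X)·t(X) and A ⊆ X, |cl A| ≤ |A|^κ. -/
theorem lemmaD {X : Type u} [TopologicalSpace X] [T2Space X] (A : Set X) :
    #↥(closure A) ≤ #↥A ^ (skL X (2 ^ (psi X * tight X)) * psi X * tight X) := by
  obtain ⟨hp0, hp⟩ := psi_spec X
  obtain ⟨ht0, ht⟩ := tight_spec X
  obtain ⟨hs0, hs⟩ := skL_spec X (2 ^ (psi X * tight X)) (power_pos _ two_pos)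
  set p := psi X
  set t := tight X
  set s := skL X (2 ^ (p * t))
  have hp1 : p ≠ 0 := (aleph0_pos.trans_le hp0).ne'
  have ht1 : t ≠ 0 := (aleph0_pos.trans_le ht0).ne'
  have hs1 : s ≠ 0 := (aleph0_pos.trans_le hs0).ne'
  have hpt : p * t ≤ s * p * t := by
    rw [mul_assoc]; exact le_mul_left hs1
  have hsk : s ≤ s * p * t := (le_mul_right hp1).trans (le_mul_right ht1)
  have hpk : p ≤ s * p * t := (le_mul_right ht1).trans hpt
  have htk : t ≤ s * p * t := le_mul_left (mul_ne_zero hs1 hp1)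
  have hκ : ℵ₀ ≤ s * p * t := ht0.trans htk
  by_cases hA : 2 ≤ #↥A
  · refine closure_card_aux A _ hκ hA (exists_nhds_aux _ hκ ?_ ?_) ?_
    · intro 𝒰 h1 h2
      obtain ⟨𝒱, h3, h4, h5⟩ := hs 𝒰 h1 h2
      exact ⟨𝒱, h3, h4.trans hsk, h5.le.trans (power_le_power_left two_ne_zero hpt)⟩
    · intro x
      obtain ⟨𝒱, h1, h2, h3⟩ := hp x
      exact ⟨𝒱, h1, h2.trans hpk, h3⟩
    · intro B x hx
      obtain ⟨C, h1, h2, h3⟩ := ht B x hx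
      exact ⟨C, h1, h2.trans htk, h3⟩
  · have hfin : A.Finite := by
      rw [← lt_aleph0_iff_set_finite]
      exact (not_le.1 hA).trans (natCast_lt_aleph0 (n := 2))
    rw [hfin.isClosed.closure_eq]
    exact self_le_power _ (one_le_aleph0.trans hκ)
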